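/- arXiv:math/9906053 — 4 statements merged into one kernel-verified Lean document; each statement's English description precedes it below -/
import Mathlib

section
/- Let d ≥ 1 and let σ, τ, π ∈ S_d satisfy σ·τ·π = 1, suppose the subgroup generated by σ, τ, π acts transitively on {1,…,d}, suppose τ is either the identity or a transposition, and suppose (d − c(σ)) + (d − c(τ)) + (d − c(π)) = 2d − 2 (the genus-zero Riemann–Hurwitz condition for a degree-d cover of the sphere branched over three points, with monodromies σ, τ, π). Then exactly one of the following holds: (1) τ = 1 and both σ and π are d-cycles (branch type (d; 1,…,1; d)); (2) τ is a transposition, σ has exactly two cycles, of lengths a and b with a + b = d, and π is a d-cycle (branch type (a,b; 2,1,…,1; a+b)); (3) τ is a transposition, σ is a d-cycle, and π has exactly two cycles, of lengths ρ and d−ρ (branch type (d; 2,1,…,1; ρ, d−ρ)). -/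
/-!
Lemma 3.2 of Li–Zhao–Zheng, in monodromy form: a connected genus-zero degree-d
cover of the sphere branched over three points, whose middle monodromy is the
identity or a transposition, has one of three branch types.
-/

/-- The number of cycles of a permutation of `Fin d`, counting fixed points
as cycles of length 1. -/
def cycleCount {d : ℕ} (σ : Equiv.Perm (Fin d)) : ℕ :=
  σ.cycleType.card + (d - σ.support.card)

/-- The cycle type of a permutation of `Fin d`, counting fixed points as
cycles of length 1. -/
def fullCycleType {d : ℕ} (σ : Equiv.Perm (Fin d)) : Multiset ℕ :=
  σ.cycleType + Multiset.replicate (d - σ.support.card) 1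

theorem card_fullCycleType {d : ℕ} (σ : Equiv.Perm (Fin d)) :
    (fullCycleType σ).card = cycleCount σ := by
  simp [fullCycleType, cycleCount]

theorem card_support_le {d : ℕ} (σ : Equiv.Perm (Fin d)) : σ.support.card ≤ d := by
  simpa using Finset.card_le_univ σ.support

theorem sum_fullCycleType {d : ℕ} (σ : Equiv.Perm (Fin d)) : (fullCycleType σ).sum = d := by
  have h := card_support_le σ
  simp only [fullCycleType, Multiset.sum_add, Equiv.Perm.sum_cycleType, Multiset.sum_replicate,
    smul_eq_mul, mul_one]
  omega

theorem one_le_of_mem_fullCycleType {d n : ℕ} {σ : Equiv.Perm (Fin d)}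
    (hn : n ∈ fullCycleType σ) : 1 ≤ n := by
  rcases Multiset.mem_add.mp hn with h | h
  · exact (Equiv.Perm.one_lt_of_mem_cycleType h).le
  · exact (Multiset.eq_of_mem_replicate h).ge

theorem cycleCount_le {d : ℕ} (σ : Equiv.Perm (Fin d)) : cycleCount σ ≤ d := by
  have h := Multiset.card_nsmul_le_sum fun n (hn : n ∈ fullCycleType σ) =>
    one_le_of_mem_fullCycleType hn
  simpa [card_fullCycleType, sum_fullCycleType] using h

theorem one_le_cycleCount {d : ℕ} (hd : 1 ≤ d) (σ : Equiv.Perm (Fin d)) :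
    1 ≤ cycleCount σ := by
  rw [← card_fullCycleType, Nat.one_le_iff_ne_zero, Ne, Multiset.card_eq_zero]
  intro h
  have hsum := sum_fullCycleType σ
  rw [h, Multiset.sum_zero] at hsum
  omega

theorem cycleCount_one {d : ℕ} : cycleCount (1 : Equiv.Perm (Fin d)) = d := by
  simp [cycleCount]

theorem cycleCount_inv {d : ℕ} (σ : Equiv.Perm (Fin d)) : cycleCount σ⁻¹ = cycleCount σ := by
  simp [cycleCount]

theorem two_le_and_cycleCount_eq_of_isSwap {d : ℕ} {τ : Equiv.Perm (Fin d)} (h : τ.IsSwap) :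
    2 ≤ d ∧ cycleCount τ = d - 1 := by
  have hs := Equiv.Perm.card_support_eq_two.mpr h
  have hle := card_support_le τ
  have hc : cycleCount τ = 1 + (d - 2) := by
    simp [cycleCount, h.isCycle.cycleType, hs]
  omega

theorem exists_fullCycleType_eq_pair {d : ℕ} {σ : Equiv.Perm (Fin d)} (h : cycleCount σ = 2) :
    ∃ a b : ℕ, 1 ≤ a ∧ 1 ≤ b ∧ a + b = d ∧ fullCycleType σ = {a, b} := by
  obtain ⟨a, b, hab⟩ := Multiset.card_eq_two.mp ((card_fullCycleType σ).trans h)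
  refine ⟨a, b, one_le_of_mem_fullCycleType (σ := σ) (by simp [hab]),
    one_le_of_mem_fullCycleType (σ := σ) (by simp [hab]), ?_, hab⟩
  simpa [hab] using sum_fullCycleType σ

theorem not_isSwap_one {d : ℕ} : ¬ (1 : Equiv.Perm (Fin d)).IsSwap := fun h => by
  simpa using Equiv.Perm.card_support_eq_two.mpr h

/-- **Lemma 3.2 (monodromy form).** Let `d ≥ 1` and let `σ, τ, π ∈ S_d` with
`σ·τ·π = 1`, generating a transitive subgroup, with `τ` the identity or a
transposition, and with total ramification `(d - c σ) + (d - c τ) + (d - c π)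
= 2d - 2` (the genus-zero Riemann–Hurwitz condition). Then exactly one of the
following holds:
1. `τ = 1` and both `σ` and `π` are `d`-cycles;
2. `τ` is a transposition, `σ` has exactly two cycles, of lengths `a` and `b`
   with `a + b = d`, and `π` is a `d`-cycle;
3. `τ` is a transposition, `σ` is a `d`-cycle, and `π` has exactly two cycles,
   of lengths `ρ` and `d - ρ`. -/
theorem three_point_genus_zero_branch_types (d : ℕ) (hd : 1 ≤ d)
    (σ τ π : Equiv.Perm (Fin d))
    (hprod : σ * τ * π = 1)
    (htrans : ∀ x y : Fin d, ∃ g ∈ Subgroup.closure ({σ, τ, π} : Set (Equiv.Perm (Fin d))),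
      g x = y)
    (hτ : τ = 1 ∨ τ.IsSwap)
    (hRH : (d - cycleCount σ) + (d - cycleCount τ) + (d - cycleCount π) = 2 * d - 2) :
    ((τ = 1 ∧ cycleCount σ = 1 ∧ cycleCount π = 1) ∧
      ¬(τ.IsSwap ∧ (∃ a b : ℕ, 1 ≤ a ∧ 1 ≤ b ∧ a + b = d ∧ fullCycleType σ = {a, b}) ∧
          cycleCount π = 1) ∧
      ¬(τ.IsSwap ∧ cycleCount σ = 1 ∧
          ∃ ρ : ℕ, 1 ≤ ρ ∧ ρ < d ∧ fullCycleType π = {ρ, d - ρ})) ∨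
    (¬(τ = 1 ∧ cycleCount σ = 1 ∧ cycleCount π = 1) ∧
      (τ.IsSwap ∧ (∃ a b : ℕ, 1 ≤ a ∧ 1 ≤ b ∧ a + b = d ∧ fullCycleType σ = {a, b}) ∧
          cycleCount π = 1) ∧
      ¬(τ.IsSwap ∧ cycleCount σ = 1 ∧
          ∃ ρ : ℕ, 1 ≤ ρ ∧ ρ < d ∧ fullCycleType π = {ρ, d - ρ})) ∨
    (¬(τ = 1 ∧ cycleCount σ = 1 ∧ cycleCount π = 1) ∧
      ¬(τ.IsSwap ∧ (∃ a b : ℕ, 1 ≤ a ∧ 1 ≤ b ∧ a + b = d ∧ fullCycleType σ = {a, b}) ∧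
          cycleCount π = 1) ∧
      (τ.IsSwap ∧ cycleCount σ = 1 ∧
          ∃ ρ : ℕ, 1 ≤ ρ ∧ ρ < d ∧ fullCycleType π = {ρ, d - ρ})) := by
  have hσ := cycleCount_le σ
  have hπ := cycleCount_le π
  have hσ' := one_le_cycleCount hd σ
  have hπ' := one_le_cycleCount hd π
  rcases hτ with rfl | hτ
  · have hinv : π = σ⁻¹ := (inv_eq_of_mul_eq_one_right (by simpa using hprod)).symm
    have hc : cycleCount π = cycleCount σ := hinv ▸ cycleCount_inv σ
    rw [cycleCount_one] at hRH
    exact .inl ⟨⟨rfl, by omega, by omega⟩, fun h => not_isSwap_one h.1,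
      fun h => not_isSwap_one h.1⟩
  · obtain ⟨hd2, hcτ⟩ := two_le_and_cycleCount_eq_of_isSwap hτ
    have hne : τ ≠ 1 := fun h => not_isSwap_one (h ▸ hτ)
    have hsum : cycleCount σ + cycleCount π = 3 := by omega
    refine .inr ?_
    rcases (by omega : cycleCount π = 1 ∨ cycleCount σ = 1) with h | h
    · have hσ2 : cycleCount σ = 2 := by omega
      exact .inl ⟨fun h' => hne h'.1, ⟨hτ, exists_fullCycleType_eq_pair hσ2, h⟩,
        fun h' => by have := h'.2.1; omega⟩
    · have hπ2 : cycleCount π = 2 := by omega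
      obtain ⟨a, b, ha, hb, hab, hπab⟩ := exists_fullCycleType_eq_pair hπ2
      refine .inr ⟨fun h' => hne h'.1, fun h' => by have := h'.2.2; omega,
        hτ, h, a, ha, by omega, ?_⟩
      rw [hπab, show b = d - a by omega]
end

section
/- Let d ≥ 1, n ≥ 0 and let σ₁,…,σ_n ∈ S_d satisfy σ₁·σ₂·⋯·σ_n = 1, and suppose the subgroup generated by σ₁,…,σ_n acts transitively on {1,…,d}. Then the total ramification Σ_{i=1}^n (d − c(σ_i)) is an even integer and is at least 2d − 2. (Equivalently, the genus g defined by 2 − 2g = 2d − Σ_{i=1}^n (d − c(σ_i)) is a nonnegative integer.) -/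
theorem finrank_span_singleton_le_one {K V : Type*} [DivisionRing K] [AddCommGroup V] [Module K V]
    (v : V) : Module.finrank K (Submodule.span K {v}) ≤ 1 := by
  simpa using finrank_span_le_card (R := K) ({v} : Set V)

/-- The permutation representation of `Perm (Fin d)` on `Fin d → ℚ`. -/
def permRep (d : ℕ) : Equiv.Perm (Fin d) →* Module.End ℚ (Fin d → ℚ) where
  toFun σ := LinearMap.funLeft ℚ ℚ (σ⁻¹ : Equiv.Perm (Fin d))
  map_one' := by ext; simp [LinearMap.funLeft]
  map_mul' σ τ := by
    apply LinearMap.ext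
    intro v
    ext x
    simp [LinearMap.funLeft]

theorem permRep_apply {d : ℕ} (σ : Equiv.Perm (Fin d)) (v : Fin d → ℚ) (x : Fin d) :
    permRep d σ v x = v (σ⁻¹ x) := rfl

theorem permRep_single {d : ℕ} (σ : Equiv.Perm (Fin d)) (x : Fin d) (a : ℚ) :
    permRep d σ (Pi.single x a) = Pi.single (σ x) a := by
  ext y
  simp only [permRep_apply, Pi.single_apply, Equiv.Perm.inv_eq_iff_eq]

/-- The rank of `σ - 1` in the permutation representation. -/
noncomputable def permRank {d : ℕ} (σ : Equiv.Perm (Fin d)) : ℕ :=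
  Module.finrank ℚ (LinearMap.range (permRep d σ - 1))

theorem permRank_one (d : ℕ) : permRank (1 : Equiv.Perm (Fin d)) = 0 := by
  rw [permRank, map_one, sub_self, LinearMap.range_zero, finrank_bot]

theorem permRank_mul_le {d : ℕ} (σ τ : Equiv.Perm (Fin d)) :
    permRank (σ * τ) ≤ permRank σ + permRank τ := by
  have h : LinearMap.range (permRep d (σ * τ) - 1) ≤
      LinearMap.range (permRep d σ - 1) ⊔ LinearMap.range (permRep d τ - 1) := by
    rintro _ ⟨v, rfl⟩
    have e : (permRep d (σ * τ) - 1) v =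
        (permRep d σ - 1) (permRep d τ v) + (permRep d τ - 1) v := by
      simp
    rw [e]
    exact Submodule.add_mem_sup ⟨_, rfl⟩ ⟨_, rfl⟩
  exact (Submodule.finrank_mono h).trans (Submodule.finrank_add_le_finrank_add_finrank _ _)

theorem permRank_swap_le {d : ℕ} (x y : Fin d) : permRank (Equiv.swap x y) ≤ 1 := by
  have h : LinearMap.range (permRep d (Equiv.swap x y) - 1) ≤
      Submodule.span ℚ {(Pi.single x 1 - Pi.single y 1 : Fin d → ℚ)} := by
    rintro _ ⟨v, rfl⟩
    refine Submodule.mem_span_singleton.2 ⟨v y - v x, ?_⟩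
    ext z
    simp only [Pi.smul_apply, Pi.sub_apply, LinearMap.sub_apply, permRep_apply, Equiv.swap_inv,
      Module.End.one_apply, Equiv.swap_apply_def, Pi.single_apply, smul_eq_mul]
    split_ifs <;> simp_all
  exact (Submodule.finrank_mono h).trans (finrank_span_singleton_le_one _)

theorem permRank_formPerm_le {d : ℕ} (l : List (Fin d)) :
    permRank l.formPerm ≤ l.length - 1 := by
  induction l with
  | nil => simp [permRank_one]
  | cons x l ih =>
    cases l with
    | nil => simp [permRank_one]
    | cons y l =>
      rw [List.formPerm_cons_cons]
      have := permRank_mul_le (Equiv.swap x y) (y :: l).formPerm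
      have := permRank_swap_le x y
      simp only [List.length_cons] at *
      omega

theorem permRank_add_card_cycleType_le {d : ℕ} (σ : Equiv.Perm (Fin d)) :
    permRank σ + σ.cycleType.card ≤ σ.support.card := by
  induction σ using Equiv.Perm.cycle_induction_on with
  | base_one => simp [permRank_one]
  | base_cycles σ hσ =>
    obtain ⟨x, hx, -⟩ := id hσ
    have h := permRank_formPerm_le (σ.toList x)
    rw [Equiv.Perm.formPerm_toList, hσ.cycleOf_eq hx, Equiv.Perm.length_toList,
      hσ.cycleOf_eq hx] at h
    have := hσ.two_le_card_support
    rw [hσ.cycleType, Multiset.card_singleton]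
    omega
  | induction_disjoint σ τ hd _ hσ hτ =>
    have := permRank_mul_le σ τ
    rw [hd.cycleType_mul, hd.card_support_mul, Multiset.card_add]
    omega

theorem sub_cycleCount {d : ℕ} (σ : Equiv.Perm (Fin d)) :
    d - cycleCount σ = σ.support.card - σ.cycleType.card := by
  have h₁ := permRank_add_card_cycleType_le σ
  have h₂ : σ.support.card ≤ d := by simpa using Finset.card_le_univ σ.support
  unfold cycleCount
  omega

theorem permRank_le_sub_cycleCount {d : ℕ} (σ : Equiv.Perm (Fin d)) :
    permRank σ ≤ d - cycleCount σ := by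
  have := permRank_add_card_cycleType_le σ
  rw [sub_cycleCount]
  omega

theorem sign_eq_neg_one_pow_sub_cycleCount {d : ℕ} (σ : Equiv.Perm (Fin d)) :
    Equiv.Perm.sign σ = (-1) ^ (d - cycleCount σ) := by
  have h := permRank_add_card_cycleType_le σ
  have e : σ.support.card + σ.cycleType.card =
      (σ.support.card - σ.cycleType.card) + 2 * σ.cycleType.card := by omega
  rw [sub_cycleCount, Equiv.Perm.sign_of_cycleType, Equiv.Perm.sum_cycleType, e, pow_add, pow_mul]
  simp

theorem even_sum_sub_cycleCount {d n : ℕ} (σ : Fin n → Equiv.Perm (Fin d))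
    (hprod : (List.ofFn σ).prod = 1) : Even (∑ i : Fin n, (d - cycleCount (σ i))) := by
  have h : (-1 : ℤˣ) ^ (∑ i : Fin n, (d - cycleCount (σ i))) = 1 := by
    rw [← Finset.prod_pow_eq_pow_sum]
    simp only [← sign_eq_neg_one_pow_sub_cycleCount]
    have h := congrArg (Equiv.Perm.sign (α := Fin d)) hprod
    rwa [map_list_prod, List.map_ofFn, List.prod_ofFn, map_one] at h
  rwa [neg_one_pow_eq_one_iff_even (by decide)] at h

theorem two_mul_sub_two_le_sum_permRank {d n : ℕ} (hd : 1 ≤ d)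
    (σ : Fin n → Equiv.Perm (Fin d)) (hprod : (List.ofFn σ).prod = 1)
    (htrans : ∀ x y : Fin d, ∃ g ∈ Subgroup.closure (Set.range σ), g x = y) :
    2 * d - 2 ≤ ∑ i : Fin n, permRank (σ i) := by
  let V := Fin d → ℚ
  let e : V := Pi.single ⟨0, hd⟩ 1
  let W : Fin n → Submodule ℚ V := fun i ↦ LinearMap.range (permRep d (σ i) - 1)
  let P : ℕ → Equiv.Perm (Fin d) := fun k ↦ ((List.ofFn σ).drop k).prod
  have hP0 : P 0 = 1 := by simpa [P] using hprod
  have hPn : P n = 1 := by simp [P, List.drop_of_length_le]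
  have hP (i : Fin n) : P i = σ i * P (i + 1) := by
    simp only [P]
    rw [List.drop_eq_getElem_cons (by simp), List.prod_cons]
    simp
  let β : V →ₗ[ℚ] (∀ i, W i) := LinearMap.pi fun i ↦
    (permRep d (σ i) - 1).rangeRestrict ∘ₗ permRep d (P (i + 1))
  let δ : (∀ i, W i) →ₗ[ℚ] V := ∑ i, (W i).subtype ∘ₗ LinearMap.proj i
  have hβ (v : V) (i : Fin n) : (β v i : V) = permRep d (P i) v - permRep d (P (i + 1)) v := by
    rw [hP i, map_mul]
    rfl
  have hδ (w : ∀ i, W i) : δ w = ∑ i, (w i : V) := by simp [δ]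
  have hβδ : LinearMap.range β ≤ LinearMap.ker δ := by
    rintro _ ⟨v, rfl⟩
    rw [LinearMap.mem_ker, hδ]
    simp only [hβ]
    rw [Fin.sum_univ_eq_sum_range (fun k ↦ permRep d (P k) v - permRep d (P (k + 1)) v),
      Finset.sum_range_sub', hP0, hPn, sub_self]
  have hker : LinearMap.ker β ≤ Submodule.span ℚ {(fun _ ↦ 1 : V)} := by
    intro v hv
    have hstep (i : Fin n) : permRep d (P i) v = permRep d (P (i + 1)) v := by
      rw [← sub_eq_zero, ← hβ, LinearMap.mem_ker.1 hv]
      rfl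
    have hall (k : ℕ) (hk : k ≤ n) : permRep d (P k) v = v := by
      induction k with
      | zero => simp [hP0]
      | succ k ih => rw [← hstep ⟨k, hk⟩, ih (by omega)]
    have hfix : ∀ g ∈ Subgroup.closure (Set.range σ), ∀ x, v (g x) = v x := by
      intro g hg
      induction hg using Subgroup.closure_induction with
      | mem g hg =>
        obtain ⟨i, rfl⟩ := hg
        intro x
        have h := hstep i
        rw [hP i, map_mul, Module.End.mul_apply, hall (i + 1) i.2] at h
        simpa [permRep_apply] using (congrFun h (σ i x)).symm
      | one => simp
      | mul g h _ _ ihg ihh => intro x; rw [Equiv.Perm.mul_apply, ihg, ihh]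
      | inv g _ ih => intro x; simpa using (ih (g⁻¹ x)).symm
    refine Submodule.mem_span_singleton.2 ⟨v ⟨0, hd⟩, ?_⟩
    ext y
    obtain ⟨g, hg, rfl⟩ := htrans ⟨0, hd⟩ y
    exact (mul_one _).trans (hfix g hg _).symm
  have hmem : ∀ g ∈ Subgroup.closure (Set.range σ), ∀ v : V,
      permRep d g v - v ∈ LinearMap.range δ := by
    intro g hg
    induction hg using Subgroup.closure_induction with
    | mem g hg =>
      obtain ⟨i, rfl⟩ := hg
      intro v
      refine ⟨Pi.single i ⟨(permRep d (σ i) - 1) v, v, rfl⟩, ?_⟩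
      rw [hδ, Finset.sum_eq_single i]
      · simp
      · intro j _ hj
        simp [Pi.single_eq_of_ne hj]
      · simp
    | one => simp
    | mul g h _ _ ihg ihh =>
      intro v
      have := add_mem (ihg (permRep d h v)) (ihh v)
      simpa using this
    | inv g _ ih =>
      intro v
      have h := neg_mem (ih (permRep d g⁻¹ v))
      rw [← Module.End.mul_apply, ← map_mul, mul_inv_cancel, map_one] at h
      simpa using h
  have hrange : (⊤ : Submodule ℚ V) ≤
      LinearMap.range δ ⊔ Submodule.span ℚ {e} := by
    rw [← (Pi.basisFun ℚ (Fin d)).span_eq, Submodule.span_le]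
    rintro _ ⟨y, rfl⟩
    obtain ⟨g, hg, rfl⟩ := htrans ⟨0, hd⟩ y
    have h := hmem g hg e
    rw [permRep_single] at h
    simpa using Submodule.add_mem_sup h (Submodule.mem_span_singleton_self e)
  have h₁ := LinearMap.finrank_range_add_finrank_ker β
  have h₂ := LinearMap.finrank_range_add_finrank_ker δ
  have h₃ := Submodule.finrank_mono hβδ
  have h₄ := (Submodule.finrank_mono hker).trans (finrank_span_singleton_le_one _)
  have h₅ := finrank_span_singleton_le_one (K := ℚ) e
  have h₆ := (Submodule.finrank_mono hrange).trans
    (Submodule.finrank_add_le_finrank_add_finrank _ _)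
  have h₇ : Module.finrank ℚ V = d := by simp [V]
  have h₈ : Module.finrank ℚ (∀ i, W i) = ∑ i, permRank (σ i) := Module.finrank_pi_fintype ℚ
  rw [finrank_top] at h₆
  omega

/-- Let `d ≥ 1`, `n ≥ 0` and `σ₁, …, σ_n ∈ S_d` with `σ₁·σ₂·⋯·σ_n = 1`,
generating a subgroup acting transitively on `{1,…,d}`. Then the total
ramification `Σ_{i=1}^n (d - c(σ_i))` is even and at least `2d - 2`. -/
theorem total_ramification_even_and_ge (d n : ℕ) (hd : 1 ≤ d)
    (σ : Fin n → Equiv.Perm (Fin d))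
    (hprod : (List.ofFn σ).prod = 1)
    (htrans : ∀ x y : Fin d, ∃ g ∈ Subgroup.closure (Set.range σ), g x = y) :
    Even (∑ i : Fin n, (d - cycleCount (σ i))) ∧
      2 * d - 2 ≤ ∑ i : Fin n, (d - cycleCount (σ i)) := by
  exact ⟨even_sum_sub_cycleCount σ hprod, (two_mul_sub_two_le_sum_permRank hd σ hprod htrans).trans
    (Finset.sum_le_sum fun i _ ↦ permRank_le_sub_cycleCount (σ i))⟩
end

section
/- Let k and ρ be integers with 1 ≤ ρ < k. Then there exists exactly one pair (α₀, x₀) with α₀ ∈ ℂ and x₀ ∈ ℂ ∖ {0, 1, 2} satisfying the two equations α₀·(x₀ − 1)^ρ·(x₀ − 2)^{k−ρ} = x₀^k and ρ·x₀·(x₀ − 2) + (k − ρ)·x₀·(x₀ − 1) − k·(x₀ − 1)·(x₀ − 2) = 0; namely x₀ = 2k/(2k − ρ) and α₀ = (2k)^k / (ρ^ρ·(2ρ − 2k)^{k−ρ}). -/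
/-!
Uniqueness of the extra double ramification point in the proof of Lemma 3.4:
for `1 ≤ ρ < k`, the system `α₀(x₀-1)^ρ(x₀-2)^{k-ρ} = x₀^k` and
`ρx₀(x₀-2) + (k-ρ)x₀(x₀-1) - k(x₀-1)(x₀-2) = 0` with `x₀ ∉ {0,1,2}` has
exactly one solution, namely `x₀ = 2k/(2k-ρ)`,
`α₀ = (2k)^k / (ρ^ρ (2ρ-2k)^{k-ρ})`. -/

/-- For integers `1 ≤ ρ < k`, a pair `(α₀, x₀) ∈ ℂ × (ℂ ∖ {0,1,2})` satisfies
`α₀·(x₀-1)^ρ·(x₀-2)^{k-ρ} = x₀^k` and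
`ρ·x₀·(x₀-2) + (k-ρ)·x₀·(x₀-1) - k·(x₀-1)·(x₀-2) = 0`
if and only if `x₀ = 2k/(2k-ρ)` and `α₀ = (2k)^k/(ρ^ρ·(2ρ-2k)^{k-ρ})`. -/
theorem unique_double_ramification_point (k ρ : ℕ) (hρ : 1 ≤ ρ) (hρk : ρ < k) :
    ∀ p : ℂ × ℂ,
      ((p.2 ≠ 0 ∧ p.2 ≠ 1 ∧ p.2 ≠ 2) ∧
        p.1 * (p.2 - 1) ^ ρ * (p.2 - 2) ^ (k - ρ) = p.2 ^ k ∧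
        (ρ : ℂ) * p.2 * (p.2 - 2) + ((k : ℂ) - (ρ : ℂ)) * p.2 * (p.2 - 1) -
            (k : ℂ) * (p.2 - 1) * (p.2 - 2) = 0)
      ↔ p = ((2 * (k : ℂ)) ^ k / ((ρ : ℂ) ^ ρ * (2 * (ρ : ℂ) - 2 * (k : ℂ)) ^ (k - ρ)),
             2 * (k : ℂ) / (2 * (k : ℂ) - (ρ : ℂ))) := by
  rintro ⟨α, x⟩
  obtain ⟨m, rfl⟩ := Nat.exists_eq_add_of_lt hρk
  have hsub : ρ + m + 1 - ρ = m + 1 := by omega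
  rw [hsub]
  have hr : (ρ : ℂ) ≠ 0 := by exact_mod_cast (by omega : ρ ≠ 0)
  have hm : (m : ℂ) + 1 ≠ 0 := by exact_mod_cast Nat.succ_ne_zero m
  have hk : 2 * ((ρ + m + 1 : ℕ) : ℂ) ≠ 0 := by
    exact_mod_cast (by omega : 2 * (ρ + m + 1) ≠ 0)
  have hd : 2 * ((ρ + m + 1 : ℕ) : ℂ) - ρ ≠ 0 := by
    have h : ((ρ + 2 * m + 2 : ℕ) : ℂ) ≠ 0 := Nat.cast_ne_zero.mpr (by omega)
    convert h using 1
    push_cast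
    ring
  have he : 2 * (ρ : ℂ) - 2 * ((ρ + m + 1 : ℕ) : ℂ) ≠ 0 := by
    have h : 2 * (ρ : ℂ) - 2 * ((ρ + m + 1 : ℕ) : ℂ) = -2 * (m + 1) := by
      push_cast
      ring
    rw [h]
    exact mul_ne_zero (by norm_num) hm
  generalize hK : ((ρ + m + 1 : ℕ) : ℂ) = K at *
  have h1 : 2 * K / (2 * K - ρ) - 1 = ρ / (2 * K - ρ) := by
    field_simp
    ring
  have h2 : 2 * K / (2 * K - ρ) - 2 = (2 * ρ - 2 * K) / (2 * K - ρ) := by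
    field_simp
    ring
  have hx : (ρ : ℂ) * x * (x - 2) + (K - ρ) * x * (x - 1) - K * (x - 1) * (x - 2) = 0 ↔
      x = 2 * K / (2 * K - ρ) := by
    rw [eq_div_iff hd, ← sub_eq_zero (a := x * _)]
    ring_nf
  have hα : α * (2 * K / (2 * K - ρ) - 1) ^ ρ * (2 * K / (2 * K - ρ) - 2) ^ (m + 1) =
        (2 * K / (2 * K - ρ)) ^ (ρ + m + 1) ↔
      α = (2 * K) ^ (ρ + m + 1) / ((ρ : ℂ) ^ ρ * (2 * ρ - 2 * K) ^ (m + 1)) := by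
    have hl : α * (ρ / (2 * K - ρ)) ^ ρ * ((2 * ρ - 2 * K) / (2 * K - ρ)) ^ (m + 1) =
        α * ((ρ : ℂ) ^ ρ * (2 * ρ - 2 * K) ^ (m + 1)) / (2 * K - ρ) ^ (ρ + m + 1) := by
      rw [div_pow, div_pow, add_assoc, pow_add (2 * K - ρ) ρ (m + 1), mul_assoc α,
        div_mul_div_comm, mul_div_assoc']
    rw [h1, h2, hl, div_pow, div_left_inj' (pow_ne_zero _ hd),
      eq_div_iff (mul_ne_zero (pow_ne_zero _ hr) (pow_ne_zero _ he))]
  simp only [Prod.mk.injEq]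
  constructor
  · rintro ⟨-, hF, hF'⟩
    obtain rfl := hx.mp hF'
    exact ⟨hα.mp hF, rfl⟩
  · rintro ⟨hα', rfl⟩
    refine ⟨⟨div_ne_zero hk hd, ?_, ?_⟩, hα.mpr hα', hx.mpr rfl⟩
    · rw [← sub_ne_zero, h1]
      exact div_ne_zero hr hd
    · rw [← sub_ne_zero, h2]
      exact div_ne_zero he hd
end

section
/- Let ρ ≥ 1 be an integer and α ∈ ℂ, and define the rational function F(x) = α·(x − 1)^ρ·(x − 2)^ρ / x^{2ρ} and the Möbius transformation π(x) = 2x/(3x − 2). Then π ∘ π is the identity (π is an involution, and π is not the identity), and F ∘ π = F as rational functions, i.e., F(2x/(3x − 2)) = F(x) for every x ∈ ℂ with x ≠ 0 and x ≠ 2/3. Hence the group of Möbius transformations preserving F contains a subgroup of order 2 generated by π. -/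
/-!
The nontrivial automorphism of the rational map
`F(x) = α(x-1)^ρ(x-2)^ρ/x^{2ρ}`: the Möbius involution `π(x) = 2x/(3x-2)`
satisfies `π ∘ π = id`, `π ≠ id`, and `F ∘ π = F`.
-/

/-- Let `ρ ≥ 1`, `α ∈ ℂ`, `F(x) = α·(x-1)^ρ·(x-2)^ρ/x^{2ρ}` and
`π(x) = 2x/(3x-2)`. Then `π` is an involution (and not the identity), and
`F(π(x)) = F(x)` for all `x ∈ ℂ` with `x ≠ 0`, `x ≠ 2/3`; hence the Möbius
transformations preserving `F` contain the order-2 subgroup generated by `π`. -/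
theorem mobius_involution_preserves_F (ρ : ℕ) (hρ : 1 ≤ ρ) (α : ℂ) :
    (∀ x : ℂ, x ≠ 2 / 3 →
      2 * (2 * x / (3 * x - 2)) / (3 * (2 * x / (3 * x - 2)) - 2) = x) ∧
    (∃ x : ℂ, 2 * x / (3 * x - 2) ≠ x) ∧
    (∀ x : ℂ, x ≠ 0 → x ≠ 2 / 3 →
      α * (2 * x / (3 * x - 2) - 1) ^ ρ * (2 * x / (3 * x - 2) - 2) ^ ρ /
          (2 * x / (3 * x - 2)) ^ (2 * ρ) =
        α * (x - 1) ^ ρ * (x - 2) ^ ρ / x ^ (2 * ρ)) := by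
  have denom_ne_zero : ∀ x : ℂ, x ≠ 2 / 3 → 3 * x - 2 ≠ 0 := fun x hx h =>
    hx (by linear_combination h / 3)
  refine ⟨fun x hx => ?_, ⟨1 / 2, by norm_num⟩, fun x h0 hx => ?_⟩
  · have hd := denom_ne_zero x hx
    have h : 3 * (2 * x / (3 * x - 2)) - 2 = 4 / (3 * x - 2) := by
      field_simp
      ring
    rw [h, ← mul_div_assoc, div_div_div_cancel_right₀ hd]
    ring
  · have hd := denom_ne_zero x hx
    have h₁ : 2 * x / (3 * x - 2) - 1 = (2 - x) / (3 * x - 2) := by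
      rw [div_sub' hd]
      congr 1
      ring
    have h₂ : 2 * x / (3 * x - 2) - 2 = 4 * (1 - x) / (3 * x - 2) := by
      rw [div_sub' hd]
      congr 1
      ring
    have h : (2 * x / (3 * x - 2) - 1) * (2 * x / (3 * x - 2) - 2) / (2 * x / (3 * x - 2)) ^ 2 =
        (x - 1) * (x - 2) / x ^ 2 := by
      rw [h₁, h₂, div_mul_div_comm, div_pow, ← pow_two, div_div_div_cancel_right₀ (pow_ne_zero 2 hd)]
      field_simp
      ring
    have factor : ∀ a b c : ℂ, α * a ^ ρ * b ^ ρ / c ^ (2 * ρ) = α * (a * b / c ^ 2) ^ ρ :=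
      fun a b c => by rw [div_pow, mul_pow, ← pow_mul, mul_assoc, mul_div_assoc]
    rw [factor, factor, h]
end
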